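/- For every natural number n, a permutation σ of {1,…,n} simultaneously avoids the barred patterns 3-1̄-42 and 2̄-41-3 if and only if σ simultaneously avoids the generalized patterns 23-1 and 31-2. Equivalently, S_n(3-1̄-42, 2̄-41-3) = S_n(23-1, 31-2). -/

import Mathlib

/-- `σ` avoids the barred pattern 3-1̄-42 (positions 0-based). -/
def Avoids3bar142 {n : ℕ} (σ : Equiv.Perm (Fin n)) : Prop :=
  ∀ i j j' : Fin n, i < j → (j : ℕ) + 1 = (j' : ℕ) → σ j' < σ i → σ i < σ j →
    ∃ k : Fin n, i < k ∧ k < j ∧ σ k < σ j'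

/-- `σ` avoids the barred pattern 2̄-41-3 (positions 0-based). -/
def AvoidsBar2dash41dash3 {n : ℕ} (σ : Equiv.Perm (Fin n)) : Prop :=
  ∀ i i' j : Fin n, (i : ℕ) + 1 = (i' : ℕ) → i' < j → σ i' < σ j → σ j < σ i →
    ∃ k : Fin n, k < i ∧ σ i' < σ k ∧ σ k < σ j

/-- `σ` avoids the generalized pattern 23-1: no positions `i`, `j` with `i+1 < j ≤ n`
and `σ(j) < σ(i) < σ(i+1)`. -/
def Avoids23dash1 {n : ℕ} (σ : Equiv.Perm (Fin n)) : Prop :=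
  ¬ ∃ i i' j : Fin n, (i : ℕ) + 1 = (i' : ℕ) ∧ i' < j ∧ σ j < σ i ∧ σ i < σ i'

/-- `σ` avoids the generalized pattern 31-2: no positions `i`, `j` with `i+1 < j`
and `σ(i+1) < σ(j) < σ(i)`. -/
def Avoids31dash2 {n : ℕ} (σ : Equiv.Perm (Fin n)) : Prop :=
  ¬ ∃ i i' j : Fin n, (i : ℕ) + 1 = (i' : ℕ) ∧ i' < j ∧ σ i' < σ j ∧ σ j < σ i

lemma crossing {n : ℕ} (P : Fin n → Prop) (a b : Fin n) (hab : a < b) (ha : P a) (hb : ¬ P b) :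
    ∃ p p' : Fin n, (p : ℕ) + 1 = (p' : ℕ) ∧ a ≤ p ∧ p' ≤ b ∧
      (∀ r, a ≤ r → r ≤ p → P r) ∧ ¬ P p' := by
  classical
  have hex : ∃ m : ℕ, ∃ h : m < n, (a : ℕ) ≤ m ∧ ¬ P ⟨m, h⟩ := ⟨b, b.2, le_of_lt hab, hb⟩
  obtain ⟨h, h1, h2⟩ := Nat.find_spec hex
  have hmin : ∀ m, m < Nat.find hex → ¬ _ := fun m hm => Nat.find_min hex hm
  have hle : Nat.find hex ≤ b := Nat.find_min' hex ⟨b.2, le_of_lt hab, hb⟩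
  generalize Nat.find hex = m at *
  have hne : (a : ℕ) ≠ m := by
    rintro rfl
    exact h2 ha
  refine ⟨⟨m - 1, by omega⟩, ⟨m, h⟩, ?_, ?_, hle, ?_, h2⟩
  · simp only; omega
  · rw [Fin.le_def]; simp only; omega
  · intro r har hr
    by_contra hP
    rw [Fin.le_def] at hr har
    simp only at hr
    exact hmin r (by omega) ⟨r.2, har, hP⟩

lemma no_31_2 {n : ℕ} (σ : Equiv.Perm (Fin n)) (h1 : Avoids3bar142 σ)
    (h2 : AvoidsBar2dash41dash3 σ) : ∀ (N : ℕ) (i i' j : Fin n), (i : ℕ) = N →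
    (i : ℕ) + 1 = (i' : ℕ) → i' < j → σ i' < σ j → σ j < σ i → False := by
  intro N
  induction N using Nat.strong_induction_on with
  | _ N ih =>
    intro i i' j hN hi hj ha hb
    obtain ⟨k, hk, hk1, hk2⟩ := h2 i i' j hi hj ha hb
    obtain ⟨m, hm, hm1, hm2⟩ := h1 k i i' hk hi hk1 (hk2.trans hb)
    obtain ⟨p, p', hp, hkp, hpm, hall, hn⟩ :=
      crossing (fun r => σ i' < σ r) k m hm hk1 (not_lt.mpr hm2.le)
    have hpp := hall p hkp le_rfl
    have hp'i : p' < i' := by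
      simp only [Fin.lt_def, Fin.le_def] at *; omega
    have hne : σ p' ≠ σ i' := fun h => hp'i.ne (σ.injective h)
    refine ih p ?_ p p' i' rfl hp hp'i (lt_of_le_of_ne (not_lt.mp hn) hne) hpp
    simp only [Fin.lt_def, Fin.le_def] at *; omega

theorem avoids_barred_iff_avoids_generalized (n : ℕ) (σ : Equiv.Perm (Fin n)) :
    (Avoids3bar142 σ ∧ AvoidsBar2dash41dash3 σ) ↔ (Avoids23dash1 σ ∧ Avoids31dash2 σ) := by
  constructor
  · rintro ⟨h1, h2⟩
    refine ⟨?_, ?_⟩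
    · rintro ⟨i, i', j, hi, hj, ha, hb⟩
      obtain ⟨p, p', hp, hkp, hpm, hall, hn⟩ :=
        crossing (fun r => σ i < σ r) i' j hj hb (not_lt.mpr ha.le)
      have hpp := hall p hkp le_rfl
      have hip : i < p := by
        simp only [Fin.lt_def, Fin.le_def] at *; omega
      have hip' : i < p' := by
        simp only [Fin.lt_def, Fin.le_def] at *; omega
      have hne : σ p' ≠ σ i := fun h => hip'.ne' (σ.injective h)
      have hlt := lt_of_le_of_ne (not_lt.mp hn) hne
      obtain ⟨k, hk, hk1, hk2⟩ := h1 i p p' hip hp hlt hpp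
      have := hall k (by simp only [Fin.lt_def, Fin.le_def] at *; omega) hk1.le
      exact lt_asymm this (hk2.trans hlt)
    · rintro ⟨i, i', j, hi, hj, ha, hb⟩
      exact no_31_2 σ h1 h2 _ i i' j rfl hi hj ha hb
  · rintro ⟨h1, h2⟩
    refine ⟨?_, ?_⟩
    · intro i j j' hij hj ha hb
      by_contra hk
      push Not at hk
      obtain ⟨p, p', hp, hkp, hpm, hall, hn⟩ :=
        crossing (fun r => σ r ≤ σ i) i j hij le_rfl (not_le.mpr hb)
      have hpp := hall p hkp le_rfl
      have hpj : p < j := by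
        simp only [Fin.lt_def, Fin.le_def] at *; omega
      have hpj' : p' < j' := by
        simp only [Fin.lt_def, Fin.le_def] at *; omega
      have hpj2 : p < j' := by
        simp only [Fin.lt_def, Fin.le_def] at *; omega
      refine h1 ⟨p, p', j', hp, hpj', ?_, lt_of_le_of_lt hpp (not_le.mp hn)⟩
      rcases hkp.eq_or_lt with rfl | hlt
      · exact ha
      · exact lt_of_le_of_ne (hk p hlt hpj) fun h => hpj2.ne' (σ.injective h)
    · intro i i' j hi hj ha hb
      exact absurd ⟨i, i', j, hi, hj, ha, hb⟩ h2
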